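/- Let V be a complex vector space with a Hermitian form ⟨·,·⟩ (linear in the first variable, conjugate-linear in the second, ⟨y,x⟩ = conj(⟨x,y⟩)). Let r₁, r₂, r₃, r' ∈ V satisfy ⟨rᵢ,rᵢ⟩ = ⟨r',r'⟩ = 3, ⟨rᵢ,r'⟩ = θ for i = 1, 2, 3, and ⟨rᵢ,rⱼ⟩ = 0 for i ≠ j. Let R₁, R₂, R₃, R' be the corresponding ω-reflections (R_v(x) = x − (1−ω)·(⟨x,v⟩/3)·v), and set ξ = r₁ + r₂ + r₃ − θr'. Then ⟨ξ,ξ⟩ = 0, ⟨ξ,rᵢ⟩ = 0 for i = 1, 2, 3, ⟨ξ,r'⟩ = 0, ξ ≠ 0 whenever r₁, r₂, r₃, r' are linearly independent, and the third power of the composition R₁∘R₂∘R₃∘R' equals the unitary transvection x ↦ x − (⟨x,ξ⟩/θ)·ξ on V. -/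

import Mathlib

noncomputable section

/-- The primitive cube root of unity `ω = e^{2πi/3}`. -/
def ω : ℂ := ⟨-1/2, Real.sqrt 3 / 2⟩

/-- `θ = ω - ω̄`, a square root of `-3`. -/
def θ : ℂ := ω - (starRingEnd ℂ) ω

lemma theta_eq : θ = ⟨0, Real.sqrt 3⟩ := by
  apply Complex.ext <;> simp [θ, ω]

lemma theta_sq : θ * θ = -3 := by
  rw [theta_eq]
  apply Complex.ext <;> simp

lemma conj_theta : (starRingEnd ℂ) θ = -θ := by
  simp [θ]

lemma omega_eq : ω = (θ - 1) / 2 := by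
  rw [theta_eq]
  apply Complex.ext <;> simp [ω]

/-- Given vectors `r₁, r₂, r₃, r'` of norm 3 in a complex Hermitian space
with `⟨rᵢ,r'⟩ = θ` and `⟨rᵢ,rⱼ⟩ = 0` for `i ≠ j`, and `ξ = r₁ + r₂ + r₃ − θr'`, one has
`⟨ξ,ξ⟩ = 0`, `⟨ξ,rᵢ⟩ = ⟨ξ,r'⟩ = 0`, `ξ ≠ 0` if `r₁, r₂, r₃, r'` are linearly
independent, and the third power of the product of the `ω`-reflections `R₁∘R₂∘R₃∘R'` is
the unitary transvection `x ↦ x − (⟨x,ξ⟩/θ)ξ`. -/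
theorem stmt_17 (V : Type*) [AddCommGroup V] [Module ℂ V]
    (h : V → V → ℂ)
    (haddl : ∀ x x' y : V, h (x + x') y = h x y + h x' y)
    (haddr : ∀ x y y' : V, h x (y + y') = h x y + h x y')
    (hsmul : ∀ (c : ℂ) (x y : V), h (c • x) y = c * h x y)
    (hconj : ∀ x y : V, h y x = (starRingEnd ℂ) (h x y))
    (r₁ r₂ r₃ r' : V)
    (hn1 : h r₁ r₁ = 3) (hn2 : h r₂ r₂ = 3) (hn3 : h r₃ r₃ = 3) (hn' : h r' r' = 3)
    (h1' : h r₁ r' = θ) (h2' : h r₂ r' = θ) (h3' : h r₃ r' = θ)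
    (h12 : h r₁ r₂ = 0) (h13 : h r₁ r₃ = 0) (h23 : h r₂ r₃ = 0)
    (R₁ R₂ R₃ R' : V → V)
    (hR1 : ∀ x, R₁ x = x - ((1 - ω) * h x r₁ / 3) • r₁)
    (hR2 : ∀ x, R₂ x = x - ((1 - ω) * h x r₂ / 3) • r₂)
    (hR3 : ∀ x, R₃ x = x - ((1 - ω) * h x r₃ / 3) • r₃)
    (hR' : ∀ x, R' x = x - ((1 - ω) * h x r' / 3) • r')
    (ξ : V)
    (hξdef : ξ = r₁ + r₂ + r₃ - θ • r') :
    h ξ ξ = 0 ∧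
    h ξ r₁ = 0 ∧ h ξ r₂ = 0 ∧ h ξ r₃ = 0 ∧ h ξ r' = 0 ∧
    (LinearIndependent ℂ ![r₁, r₂, r₃, r'] → ξ ≠ 0) ∧
    (∀ x : V, (R₁ ∘ R₂ ∘ R₃ ∘ R')^[3] x = x - (h x ξ / θ) • ξ) := by
  have hsq := theta_sq
  have hθ0 : θ ≠ 0 := by
    intro h0
    norm_num [h0] at hsq
  have hinv (z : ℂ) : z / θ = -(θ * z) / 3 := by
    rw [div_eq_iff hθ0]
    linear_combination (z / 3) * hsq
  have hsub (x y z : V) : h (x - y) z = h x z - h y z := by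
    rw [sub_eq_add_neg, haddl, ← neg_one_smul ℂ y, hsmul]
    ring
  have hsymm0 {x y : V} (hxy : h x y = 0) : h y x = 0 := by
    rw [hconj x y, hxy, map_zero]
  have hsymmθ {x y : V} (hxy : h x y = θ) : h y x = -θ := by
    rw [hconj x y, hxy, conj_theta]
  have h21 := hsymm0 h12
  have h31 := hsymm0 h13
  have h32 := hsymm0 h23
  have h1 := hsymmθ h1'
  have h2 := hsymmθ h2'
  have h3 := hsymmθ h3'
  have hξ1 : h ξ r₁ = 0 := by
    simp only [hξdef, hsub, haddl, hsmul, hn1, h21, h31, h1]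
    linear_combination hsq
  have hξ2 : h ξ r₂ = 0 := by
    simp only [hξdef, hsub, haddl, hsmul, hn2, h12, h32, h2]
    linear_combination hsq
  have hξ3 : h ξ r₃ = 0 := by
    simp only [hξdef, hsub, haddl, hsmul, hn3, h13, h23, h3]
    linear_combination hsq
  have hξ' : h ξ r' = 0 := by
    simp only [hξdef, hsub, haddl, hsmul, hn', h1', h2', h3']
    ring
  have hxξ (x : V) : h x ξ = h x r₁ + h x r₂ + h x r₃ + θ * h x r' := by
    rw [hconj ξ x, hξdef, hsub, haddl, haddl, hsmul, hconj x r₁, hconj x r₂, hconj x r₃,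
      hconj x r']
    simp [conj_theta]
  refine ⟨?_, hξ1, hξ2, hξ3, hξ', ?_, fun x ↦ ?_⟩
  · rw [hxξ, hξ1, hξ2, hξ3, hξ']
    ring
  · intro hli h0
    have hsum := Fintype.linearIndependent_iff.1 hli ![1, 1, 1, -θ] (by
      simpa [Fin.sum_univ_four, sub_eq_add_neg] using hξdef.symm.trans h0) 0
    simp at hsum
  have hstep (x : V) : (R₁ ∘ R₂ ∘ R₃ ∘ R') x =
      x - ((3 - θ) / 6 * h x r₁ + (3 + θ) / 6 * h x r') • r₁
        - ((3 - θ) / 6 * h x r₂ + (3 + θ) / 6 * h x r') • r₂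
        - ((3 - θ) / 6 * h x r₃ + (3 + θ) / 6 * h x r') • r₃
        - ((3 - θ) / 6 * h x r') • r' := by
    simp only [Function.comp_apply, hR1, hR2, hR3, hR', hsub, hsmul, h21, h31, h32, h1, h2, h3,
      omega_eq]
    match_scalars <;> grind
  have hp1 (x : V) : h ((R₁ ∘ R₂ ∘ R₃ ∘ R') x) r₁ = (θ - 1) / 2 * h x r₁ - h x r' := by
    simp only [hstep, hsub, hsmul, hn1, h21, h31, h1]
    grind
  have hp2 (x : V) : h ((R₁ ∘ R₂ ∘ R₃ ∘ R') x) r₂ = (θ - 1) / 2 * h x r₂ - h x r' := by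
    simp only [hstep, hsub, hsmul, hn2, h12, h32, h2]
    grind
  have hp3 (x : V) : h ((R₁ ∘ R₂ ∘ R₃ ∘ R') x) r₃ = (θ - 1) / 2 * h x r₃ - h x r' := by
    simp only [hstep, hsub, hsmul, hn3, h13, h23, h3]
    grind
  have hp' (x : V) : h ((R₁ ∘ R₂ ∘ R₃ ∘ R') x) r' =
      (1 - θ) * h x r' - (1 + θ) / 2 * (h x r₁ + h x r₂ + h x r₃) := by
    simp only [hstep, hsub, hsmul, hn', h1', h2', h3']
    grind
  generalize R₁ ∘ R₂ ∘ R₃ ∘ R' = T at hstep hp1 hp2 hp3 hp' ⊢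
  rw [Function.iterate_succ_apply', Function.iterate_succ_apply', Function.iterate_one,
    hstep (T (T x))]
  simp only [hp1, hp2, hp3, hp']
  rw [hstep (T x)]
  simp only [hp1, hp2, hp3, hp']
  rw [hstep x, hxξ, hinv, hξdef]
  clear * - hsq
  match_scalars <;> grind
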